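/- arXiv:1904.11188 — 2 statements merged into one kernel-verified Lean document; each statement's English description precedes it below -/
import Mathlib

section
/- Fix λ ≥ 0, a cost vector s ∈ ℝ^n with s ≥ 0, and a classical-quantum channel (ρ_x)_{x∈X}. For any probability distribution p on X with p_x > 0 for all x, the maximum of f_λ(p, p') over strictly positive probability distributions p' equals χ(p) − λ sᵀp, i.e., max_{p'} f_λ(p, p') = f_λ(p, p) = H(Σ_x p_x ρ_x) − Σ_x p_x H(ρ_x) − λ sᵀp. -/
open Matrix Finset Filter ComplexOrder

/-- Matrix logarithm on the support: for a Hermitian matrix, apply `Real.log`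
to the eigenvalues (note `Real.log 0 = 0`, giving the logarithm on the support);
junk value `0` otherwise. -/
noncomputable def mlog {k : ℕ} (A : Matrix (Fin k) (Fin k) ℂ) : Matrix (Fin k) (Fin k) ℂ :=
  if h : A.IsHermitian then
    (h.eigenvectorUnitary : Matrix (Fin k) (Fin k) ℂ) *
      Matrix.diagonal (fun i => (Real.log (h.eigenvalues i) : ℂ)) *
      (star (h.eigenvectorUnitary : Matrix (Fin k) (Fin k) ℂ))
  else 0

/-- A density matrix: positive semidefinite with unit trace. -/
def IsDensity {k : ℕ} (ρ : Matrix (Fin k) (Fin k) ℂ) : Prop :=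
  ρ.PosSemidef ∧ ρ.trace = 1

/-- A probability distribution on `Fin k`. -/
def IsDist {k : ℕ} (p : Fin k → ℝ) : Prop :=
  (∀ x, 0 ≤ p x) ∧ ∑ x, p x = 1

/-- `supp ρ ⊆ supp σ`, expressed as `ker σ ⊆ ker ρ`. -/
def SuppLE {k : ℕ} (ρ σ : Matrix (Fin k) (Fin k) ℂ) : Prop :=
  ∀ v, σ.mulVec v = 0 → ρ.mulVec v = 0

/-- Quantum relative entropy `D(ρ‖σ) = Tr[ρ(log ρ − log σ)]` (natural log). -/
noncomputable def qRelEnt {k : ℕ} (ρ σ : Matrix (Fin k) (Fin k) ℂ) : ℝ :=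
  (Matrix.trace (ρ * (mlog ρ - mlog σ))).re

/-- Von Neumann entropy `H(ρ) = −Tr(ρ log ρ)` (natural log). -/
noncomputable def vN {k : ℕ} (ρ : Matrix (Fin k) (Fin k) ℂ) : ℝ :=
  -(Matrix.trace (ρ * mlog ρ)).re

/-- Classical relative entropy `D(p‖q)`. -/
noncomputable def cRelEnt {k : ℕ} (p q : Fin k → ℝ) : ℝ :=
  ∑ x, p x * (Real.log (p x) - Real.log (q x))

/-- Holevo quantity `χ(p) = H(Σ_x p_x ρ_x) − Σ_x p_x H(ρ_x)`. -/
noncomputable def holevo {n m : ℕ} (ρ : Fin n → Matrix (Fin m) (Fin m) ℂ)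
    (p : Fin n → ℝ) : ℝ :=
  vN (∑ x, (p x : ℂ) • ρ x) - ∑ x, p x * vN (ρ x)

/-- `f_λ(p, p') = Σ_x Tr{p_x ρ_x [log(p'_x ρ_x) − log(p_x ρ')]} − λ sᵀp`,
where `ρ' = Σ_x p'_x ρ_x`. -/
noncomputable def fBA {n m : ℕ} (ρ : Fin n → Matrix (Fin m) (Fin m) ℂ)
    (s : Fin n → ℝ) (lam : ℝ) (p p' : Fin n → ℝ) : ℝ :=
  (∑ x, (Matrix.trace (((p x : ℂ) • ρ x) *
      (mlog ((p' x : ℂ) • ρ x) - mlog ((p x : ℂ) • ∑ y, (p' y : ℂ) • ρ y)))).re)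
    - lam * ∑ x, s x * p x

/-- `r_x = exp(Tr{ρ_x[log(p_x ρ_x) − log ρ̄]} − λ s_x)` with `ρ̄ = Σ_y p_y ρ_y`. -/
noncomputable def rBA {n m : ℕ} (ρ : Fin n → Matrix (Fin m) (Fin m) ℂ)
    (s : Fin n → ℝ) (lam : ℝ) (p : Fin n → ℝ) (x : Fin n) : ℝ :=
  Real.exp ((Matrix.trace (ρ x *
      (mlog ((p x : ℂ) • ρ x) - mlog (∑ y, (p y : ℂ) • ρ y)))).re - lam * s x)

/-- One Blahut–Arimoto update step. -/
noncomputable def baStep {n m : ℕ} (ρ : Fin n → Matrix (Fin m) (Fin m) ℂ)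
    (s : Fin n → ℝ) (lam : ℝ) (p : Fin n → ℝ) (x : Fin n) : ℝ :=
  rBA ρ s lam p x / ∑ y, rBA ρ s lam p y

/-- The Blahut–Arimoto iterates starting from `p0`. -/
noncomputable def baSeq {n m : ℕ} (ρ : Fin n → Matrix (Fin m) (Fin m) ℂ)
    (s : Fin n → ℝ) (lam : ℝ) (p0 : Fin n → ℝ) : ℕ → Fin n → ℝ
  | 0 => p0
  | t + 1 => baStep ρ s lam (baSeq ρ s lam p0 t)

open MeasureTheory

lemma relEntropyKernel_integrable_and_integral {a b : ℝ} (ha : 0 ≤ a) (hb : 0 ≤ b)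
    (hab : b = 0 → a = 0) :
    IntegrableOn (fun t : ℝ => (a - b) ^ 2 / (b + t * a) * (1 / (1 + t) ^ 2)) (Set.Ioi 0) ∧
    ∫ t in Set.Ioi (0 : ℝ), (a - b) ^ 2 / (b + t * a) * (1 / (1 + t) ^ 2) =
      a * (Real.log a - Real.log b) - a + b := by
  rcases hb.eq_or_lt with hb0 | hb0
  · obtain rfl := hb0
    obtain rfl := hab rfl
    simp
  let g : ℝ → ℝ := fun t =>
    (a - b) * (1 + t)⁻¹ + a * (Real.log (b + t * a) - Real.log (1 + t))
  have hderiv : ∀ t ∈ Set.Ici (0 : ℝ),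
      HasDerivAt g ((a - b) ^ 2 / (b + t * a) * (1 / (1 + t) ^ 2)) t := by
    intro t ht
    have ht : (0 : ℝ) ≤ t := ht
    have h1 : 1 + t ≠ 0 := by positivity
    have h2 : b + t * a ≠ 0 := by positivity
    have d1 : HasDerivAt (fun t : ℝ => 1 + t) 1 t := (hasDerivAt_id t).const_add 1
    have d2 : HasDerivAt (fun t : ℝ => b + t * a) a t := by
      simpa using ((hasDerivAt_id t).mul_const a).const_add b
    refine (((d1.inv h1).const_mul (a - b)).add
      (((d2.log h2).sub (d1.log h1)).const_mul a)).congr_deriv ?_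
    field_simp
    ring
  have hnonneg : ∀ t ∈ Set.Ioi (0 : ℝ),
      0 ≤ (a - b) ^ 2 / (b + t * a) * (1 / (1 + t) ^ 2) := by
    intro t ht
    have ht : (0 : ℝ) < t := ht
    positivity
  have hinv : Tendsto (fun t : ℝ => (1 + t)⁻¹) atTop (nhds 0) :=
    tendsto_inv_atTop_zero.comp (tendsto_atTop_add_const_left _ 1 tendsto_id)
  have hlim : Tendsto g atTop (nhds (a * Real.log a)) := by
    have hlog : Tendsto (fun t : ℝ => a * (Real.log (b + t * a) - Real.log (1 + t))) atTop
        (nhds (a * Real.log a)) := by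
      rcases ha.eq_or_lt with ha0 | ha0
      · simp [← ha0]
      refine Tendsto.const_mul a ?_
      have h3 : Tendsto (fun t : ℝ => a + (b - a) * (1 + t)⁻¹) atTop (nhds a) := by
        simpa using (hinv.const_mul (b - a)).const_add a
      refine (h3.log ha0.ne').congr' ?_
      filter_upwards [eventually_ge_atTop 0] with t ht
      have h1 : 1 + t ≠ 0 := by positivity
      have h2 : b + t * a ≠ 0 := by positivity
      rw [← Real.log_div h2 h1]
      congr 1
      field_simp
      ring
    simpa using (hinv.const_mul (a - b)).add hlog
  refine ⟨integrableOn_Ioi_deriv_of_nonneg' hderiv hnonneg hlim, ?_⟩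
  rw [integral_Ioi_of_hasDerivAt_of_nonneg' hderiv hnonneg hlim]
  simp [g]
  ring

lemma sum_mul_log_sub_le_of_kernel_le {ι κ : Type*} [Fintype ι] [Fintype κ]
    {w a b : ι → ℝ} {p q : κ → ℝ}
    (ha : ∀ i, 0 ≤ a i) (hb : ∀ i, 0 ≤ b i) (hw : ∀ i, b i = 0 → w i = 0 ∨ a i = 0)
    (hp : ∀ x, 0 ≤ p x) (hq : ∀ x, 0 < q x)
    (h : ∀ t : ℝ, 0 < t → ∑ i, w i * ((a i - b i) ^ 2 / (b i + t * a i)) ≤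
      ∑ x, (p x - q x) ^ 2 / (q x + t * p x)) :
    ∑ i, w i * (a i * (Real.log (a i) - Real.log (b i)) - a i + b i) ≤
      ∑ x, (p x * (Real.log (p x) - Real.log (q x)) - p x + q x) := by
  have hl : ∀ i, IntegrableOn (fun t : ℝ => w i * ((a i - b i) ^ 2 / (b i + t * a i) *
        (1 / (1 + t) ^ 2))) (Set.Ioi 0) ∧
      ∫ t in Set.Ioi (0 : ℝ), w i * ((a i - b i) ^ 2 / (b i + t * a i) * (1 / (1 + t) ^ 2)) =
        w i * (a i * (Real.log (a i) - Real.log (b i)) - a i + b i) := by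
    intro i
    by_cases hwi : w i = 0
    · simp [hwi]
    obtain ⟨h1, h2⟩ := relEntropyKernel_integrable_and_integral (ha i) (hb i)
      (fun h0 => (hw i h0).resolve_left hwi)
    exact ⟨h1.const_mul _, by rw [integral_const_mul, h2]⟩
  have hr := fun x => relEntropyKernel_integrable_and_integral (hp x) (hq x).le
    (fun h0 => absurd h0 (hq x).ne')
  rw [← Finset.sum_congr rfl fun i _ => (hl i).2, ← Finset.sum_congr rfl fun x _ => (hr x).2,
    ← integral_finsetSum _ fun i _ => (hl i).1, ← integral_finsetSum _ fun x _ => (hr x).1]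
  refine setIntegral_mono_on (integrable_finsetSum _ fun i _ => (hl i).1)
    (integrable_finsetSum _ fun x _ => (hr x).1) measurableSet_Ioi fun t ht => ?_
  have h1 := mul_le_mul_of_nonneg_right (h t ht) (by positivity : 0 ≤ 1 / (1 + t) ^ 2)
  simpa only [Finset.sum_mul, mul_assoc] using h1

section Spectral

variable {k : ℕ} {A B : Matrix (Fin k) (Fin k) ℂ}

lemma trace_mul_conj_diagonal (C V : Matrix (Fin k) (Fin k) ℂ) (d : Fin k → ℂ) :
    (C * (V * diagonal d * star V)).trace = ∑ j, d j * (star V * C * V) j j := by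
  rw [← Matrix.mul_assoc, ← Matrix.mul_assoc, Matrix.trace_mul_comm, ← Matrix.mul_assoc,
    ← Matrix.mul_assoc, Matrix.trace]
  simp [Matrix.mul_diagonal, mul_comm]

lemma spectral_eq (hA : A.IsHermitian) :
    A = (hA.eigenvectorUnitary : Matrix (Fin k) (Fin k) ℂ) *
      diagonal (fun i => (hA.eigenvalues i : ℂ)) *
      star (hA.eigenvectorUnitary : Matrix (Fin k) (Fin k) ℂ) := by
  conv_lhs => rw [hA.spectral_theorem]
  rfl

lemma mlog_smul_eq (hB : B.IsHermitian) (c : ℝ) :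
    mlog ((c : ℂ) • B) = (hB.eigenvectorUnitary : Matrix (Fin k) (Fin k) ℂ) *
      diagonal (fun i => (Real.log (c * hB.eigenvalues i) : ℂ)) *
      star (hB.eigenvectorUnitary : Matrix (Fin k) (Fin k) ℂ) := by
  have hfin : (spectrum ℝ B).Finite := Matrix.finite_real_spectrum
  have hsmul : (c : ℂ) • B = c • B := Complex.coe_smul c B
  have hcB : (c • B).IsHermitian := hB.smul (IsSelfAdjoint.all c)
  have h1 : mlog (c • B) = cfc Real.log (c • B) := by
    rw [hcB.cfc_eq, mlog, dif_pos hcB]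
    rfl
  rw [hsmul, h1, ← cfc_comp_smul c Real.log B ((hfin.image _).continuousOn _) hB.isSelfAdjoint,
    hB.cfc_eq]
  rfl

lemma mlog_eq (hB : B.IsHermitian) :
    mlog B = (hB.eigenvectorUnitary : Matrix (Fin k) (Fin k) ℂ) *
      diagonal (fun i => (Real.log (hB.eigenvalues i) : ℂ)) *
      star (hB.eigenvectorUnitary : Matrix (Fin k) (Fin k) ℂ) := by
  rw [mlog, dif_pos hB]

lemma SuppLE.mul_eigenvector_eq_zero (h : SuppLE A B) (hB : B.IsHermitian) {j : Fin k}
    (hj : hB.eigenvalues j = 0) :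
    A *ᵥ (hB.eigenvectorUnitary : Matrix (Fin k) (Fin k) ℂ).col j = 0 := by
  apply h
  have := hB.mulVec_eigenvectorBasis j
  rw [hj, zero_smul] at this
  rw [hB.eigenvectorUnitary_col_eq]
  exact this

lemma SuppLE.conj_apply_eq_zero (h : SuppLE A B) (hB : B.IsHermitian) {j : Fin k}
    (hj : hB.eigenvalues j = 0) (C : Matrix (Fin k) (Fin k) ℂ) (i : Fin k) :
    (C * A * (hB.eigenvectorUnitary : Matrix (Fin k) (Fin k) ℂ)) i j = 0 := by
  have h0 := h.mul_eigenvector_eq_zero hB hj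
  have : (A * (hB.eigenvectorUnitary : Matrix (Fin k) (Fin k) ℂ)).col j = 0 := by
    rw [← h0]; rfl
  rw [Matrix.mul_assoc, Matrix.mul_apply]
  refine Finset.sum_eq_zero fun l _ => ?_
  have hl : (A * (hB.eigenvectorUnitary : Matrix (Fin k) (Fin k) ℂ)) l j = 0 := congrFun this l
  rw [hl, mul_zero]

lemma trace_star_mul_mul_unitary (C : Matrix (Fin k) (Fin k) ℂ)
    (V : Matrix.unitaryGroup (Fin k) ℂ) :
    (star (V : Matrix (Fin k) (Fin k) ℂ) * C * V).trace = C.trace := by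
  rw [Matrix.trace_mul_cycle]
  simp

lemma trace_mul_mlog_smul (hB : B.IsHermitian) (h : SuppLE A B) {c : ℝ} (hc : 0 < c) :
    (A * mlog ((c : ℂ) • B)).trace = Real.log c * A.trace + (A * mlog B).trace := by
  rw [mlog_smul_eq hB, mlog_eq hB, trace_mul_conj_diagonal, trace_mul_conj_diagonal,
    ← trace_star_mul_mul_unitary A hB.eigenvectorUnitary, Matrix.trace, Finset.mul_sum,
    ← Finset.sum_add_distrib]
  refine Finset.sum_congr rfl fun j _ => ?_
  by_cases hj : hB.eigenvalues j = 0
  · simp [h.conj_apply_eq_zero hB hj]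
  · rw [Real.log_mul hc.ne' hj, Matrix.diag_apply]
    push_cast
    ring

end Spectral

section Density

variable {k : ℕ} {σ : Matrix (Fin k) (Fin k) ℂ}

lemma IsDensity.two_mul_re_trace_sub_sq_le (hσ : IsDensity σ) (Y : Matrix (Fin k) (Fin k) ℂ)
    (r : ℝ) : 2 * r * (σ * Y).trace.re - r ^ 2 ≤ (σ * (Y * star Y)).trace.re := by
  have h := (hσ.1.conjTranspose_mul_mul_same (Y - (r : ℂ) • 1)).trace_nonneg
  rw [Matrix.trace_mul_cycle, Matrix.trace_mul_comm] at h
  have hconj : (σ * star Y).trace = star (σ * Y).trace := by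
    rw [← Matrix.trace_conjTranspose, Matrix.conjTranspose_mul, hσ.1.1.eq, Matrix.trace_mul_comm]
    rfl
  have hre : (σ * ((Y - (r : ℂ) • 1) * (Y - (r : ℂ) • 1)ᴴ)).trace =
      (σ * (Y * star Y)).trace - r * (σ * Y).trace - r * (σ * star Y).trace + r ^ 2 := by
    simp only [Matrix.conjTranspose_sub, Matrix.conjTranspose_smul, Matrix.conjTranspose_one,
      Matrix.mul_sub, Matrix.sub_mul, Matrix.trace_sub, Matrix.mul_smul, Matrix.smul_mul,
      Matrix.mul_one, Matrix.one_mul, Matrix.trace_smul, hσ.2, smul_eq_mul,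
      Complex.star_def, Complex.conj_ofReal, Matrix.star_eq_conjTranspose]
    ring
  rw [hre, hconj] at h
  have h' := (Complex.le_def.1 h).1
  simp [← Complex.ofReal_pow] at h'
  linarith

lemma IsDensity.two_mul_re_trace_sub_sq_le' (hσ : IsDensity σ) (Y : Matrix (Fin k) (Fin k) ℂ)
    (r : ℝ) : 2 * r * (σ * Y).trace.re - r ^ 2 ≤ (σ * (star Y * Y)).trace.re := by
  have h := hσ.two_mul_re_trace_sub_sq_le (star Y) r
  have hconj : (σ * star Y).trace = star (σ * Y).trace := by
    rw [← Matrix.trace_conjTranspose, Matrix.conjTranspose_mul, hσ.1.1.eq, Matrix.trace_mul_comm]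
    rfl
  rw [hconj, star_star] at h
  simpa using h

lemma IsDensity.quadratic_form_le (hσ : IsDensity σ) (Y : Matrix (Fin k) (Fin k) ℂ)
    {p q t : ℝ} (hp : 0 ≤ p) (hq : 0 < q) (ht : 0 < t) :
    2 * (p - q) * (σ * Y).trace.re - q * (σ * (Y * star Y)).trace.re -
      t * p * (σ * (star Y * Y)).trace.re ≤ (p - q) ^ 2 / (q + t * p) := by
  have hpos : 0 < q + t * p := by positivity
  obtain ⟨r, hr⟩ : ∃ r, r = (p - q) / (q + t * p) := ⟨_, rfl⟩
  have hr' : p - q = r * (q + t * p) := by rw [hr]; field_simp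
  have hdiv : (p - q) ^ 2 / (q + t * p) = r ^ 2 * (q + t * p) := by
    rw [hr']; field_simp
  have h1 := mul_le_mul_of_nonneg_left (hσ.two_mul_re_trace_sub_sq_le Y r) hq.le
  have h2 := mul_le_mul_of_nonneg_left (hσ.two_mul_re_trace_sub_sq_le' Y r)
    (by positivity : 0 ≤ t * p)
  rw [hdiv, hr']
  linarith

end Density

section Mixture

variable {n k : ℕ} {ρ : Fin n → Matrix (Fin k) (Fin k) ℂ} {p q : Fin n → ℝ}

lemma posSemidef_mixture (hρ : ∀ x, IsDensity (ρ x)) (hp : ∀ x, 0 ≤ p x) :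
    (∑ x, (p x : ℂ) • ρ x).PosSemidef :=
  Matrix.posSemidef_sum _ fun x _ => (hρ x).1.smul (by exact_mod_cast hp x)

lemma suppLE_mixture (hρ : ∀ x, IsDensity (ρ x)) (hq : ∀ x, 0 < q x) (x : Fin n) :
    SuppLE (ρ x) (∑ y, (q y : ℂ) • ρ y) := by
  intro v hv
  have h0 : ∑ y, (q y : ℂ) * (star v ⬝ᵥ ρ y *ᵥ v) = 0 := by
    have := congrArg (fun u => star v ⬝ᵥ u) hv
    simpa [Matrix.sum_mulVec, dotProduct_sum, Matrix.smul_mulVec] using this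
  have hnonneg : ∀ y ∈ Finset.univ, 0 ≤ (q y : ℂ) * (star v ⬝ᵥ ρ y *ᵥ v) := fun y _ =>
    mul_nonneg (by exact_mod_cast (hq y).le) ((hρ y).1.dotProduct_mulVec_nonneg v)
  have h1 := (Finset.sum_eq_zero_iff_of_nonneg hnonneg).1 h0 x (Finset.mem_univ x)
  have hqx : (q x : ℂ) ≠ 0 := by exact_mod_cast (hq x).ne'
  exact ((hρ x).1.dotProduct_mulVec_zero_iff v).1 ((mul_eq_zero.1 h1).resolve_left hqx)

lemma suppLE_mixture_mixture (hρ : ∀ x, IsDensity (ρ x)) (hq : ∀ x, 0 < q x) :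
    SuppLE (∑ x, (p x : ℂ) • ρ x) (∑ x, (q x : ℂ) • ρ x) := by
  intro v hv
  rw [Matrix.sum_mulVec]
  refine Finset.sum_eq_zero fun x _ => ?_
  rw [Matrix.smul_mulVec, suppLE_mixture hρ hq x v hv, smul_zero]

lemma re_trace_mixture_mul (p : Fin n → ℝ) (Y : Matrix (Fin k) (Fin k) ℂ) :
    ((∑ x, (p x : ℂ) • ρ x) * Y).trace.re = ∑ x, p x * (ρ x * Y).trace.re := by
  simp [Finset.sum_mul, Matrix.trace_sum]

end Mixture

section Overlap

variable {k : ℕ} {A B : Matrix (Fin k) (Fin k) ℂ}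

/-- Squared modulus of the inner product of the `j`-th eigenvector of `B` with the `i`-th
eigenvector of `A`. -/
noncomputable def overlap (hA : A.IsHermitian) (hB : B.IsHermitian) (j i : Fin k) : ℝ :=
  Complex.normSq ((star (hB.eigenvectorUnitary : Matrix (Fin k) (Fin k) ℂ) *
    (hA.eigenvectorUnitary : Matrix (Fin k) (Fin k) ℂ)) j i)

lemma trace_mul_diagonal_conj (W y : Matrix (Fin k) (Fin k) ℂ) (a : Fin k → ℂ) :
    (diagonal a * (star W * y)).trace = ∑ j, ∑ i, a i * (star (W j i) * y j i) := by
  rw [Finset.sum_comm, Matrix.trace]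
  simp only [Matrix.diag_apply, Matrix.diagonal_mul]
  simp [Matrix.mul_apply, Finset.mul_sum, Matrix.star_apply]

lemma trace_diagonal_mul_conj (W y : Matrix (Fin k) (Fin k) ℂ) (b : Fin k → ℂ) :
    (diagonal b * (y * star W)).trace = ∑ j, ∑ i, b j * (y j i * star (W j i)) := by
  simp only [Matrix.trace, Matrix.diag_apply, Matrix.diagonal_mul]
  simp [Matrix.mul_apply, Finset.mul_sum, Matrix.star_apply]

lemma trace_spectral_left {U : Matrix.unitaryGroup (Fin k) ℂ} (d C : Matrix (Fin k) (Fin k) ℂ) :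
    ((U : Matrix (Fin k) (Fin k) ℂ) * d * star (U : Matrix (Fin k) (Fin k) ℂ) * C).trace =
      (d * (star (U : Matrix (Fin k) (Fin k) ℂ) * C * U)).trace := by
  rw [Matrix.mul_assoc, Matrix.mul_assoc, Matrix.trace_mul_comm, Matrix.mul_assoc]

/-- The quadratic form dual to the relative entropy kernel is attained. -/
lemma exists_kernel_eq_quadratic_form (hA : A.IsHermitian) (hB : B.IsHermitian) (t : ℝ) :
    ∃ Y : Matrix (Fin k) (Fin k) ℂ,
      ∑ j, ∑ i, overlap hA hB j i * ((hA.eigenvalues i - hB.eigenvalues j) ^ 2 /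
        (hB.eigenvalues j + t * hA.eigenvalues i)) =
      2 * ((A * Y).trace.re - (B * Y).trace.re) - (B * (Y * star Y)).trace.re -
        t * (A * (star Y * Y)).trace.re := by
  set U := hA.eigenvectorUnitary with hU
  set V := hB.eigenvectorUnitary with hV
  set a := hA.eigenvalues
  set b := hB.eigenvalues
  set W : Matrix (Fin k) (Fin k) ℂ := star (V : Matrix (Fin k) (Fin k) ℂ) * U with hW
  let r : Fin k → Fin k → ℝ := fun j i => (a i - b j) / (b j + t * a i)
  let y : Matrix (Fin k) (Fin k) ℂ := Matrix.of fun j i => (r j i : ℂ) * W j i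
  have hUU : star (U : Matrix (Fin k) (Fin k) ℂ) * U = 1 := Unitary.coe_star_mul_self U
  have hVV : star (V : Matrix (Fin k) (Fin k) ℂ) * V = 1 := Unitary.coe_star_mul_self V
  have hUU' (M : Matrix (Fin k) (Fin k) ℂ) :
      star (U : Matrix (Fin k) (Fin k) ℂ) * (U * M) = M := by
    rw [← Matrix.mul_assoc, hUU, Matrix.one_mul]
  have hVV' (M : Matrix (Fin k) (Fin k) ℂ) :
      star (V : Matrix (Fin k) (Fin k) ℂ) * (V * M) = M := by
    rw [← Matrix.mul_assoc, hVV, Matrix.one_mul]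
  have hAeq := spectral_eq hA
  have hBeq := spectral_eq hB
  rw [← hU] at hAeq
  rw [← hV] at hBeq
  refine ⟨V * y * star (U : Matrix (Fin k) (Fin k) ℂ), ?_⟩
  have e1 : (A * (V * y * star (U : Matrix (Fin k) (Fin k) ℂ))).trace =
      (diagonal (fun i => (a i : ℂ)) * (star W * y)).trace := by
    conv_lhs => rw [hAeq]
    rw [trace_spectral_left]
    simp only [hW, star_mul, star_star, Matrix.mul_assoc, hUU, Matrix.mul_one]
    rfl
  have e2 : (B * (V * y * star (U : Matrix (Fin k) (Fin k) ℂ))).trace =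
      (diagonal (fun i => (b i : ℂ)) * (y * star W)).trace := by
    conv_lhs => rw [hBeq]
    rw [trace_spectral_left]
    simp only [hW, star_mul, star_star, Matrix.mul_assoc, hVV']
    rfl
  have e3 : (B * (V * y * star (U : Matrix (Fin k) (Fin k) ℂ) *
      star (V * y * star (U : Matrix (Fin k) (Fin k) ℂ)))).trace =
      (diagonal (fun i => (b i : ℂ)) * (y * star y)).trace := by
    conv_lhs => rw [hBeq]
    rw [trace_spectral_left]
    simp only [star_mul, star_star, Matrix.mul_assoc, hVV', hUU', hVV, Matrix.mul_one]
    rfl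
  have e4 : (A * (star (V * y * star (U : Matrix (Fin k) (Fin k) ℂ)) *
      (V * y * star (U : Matrix (Fin k) (Fin k) ℂ)))).trace =
      (diagonal (fun i => (a i : ℂ)) * (star y * y)).trace := by
    conv_lhs => rw [hAeq]
    rw [trace_spectral_left]
    simp only [star_mul, star_star, Matrix.mul_assoc, hVV', hUU', hUU, Matrix.mul_one]
    rfl
  rw [e1, e2, e3, e4, trace_mul_diagonal_conj, trace_diagonal_mul_conj, trace_diagonal_mul_conj,
    trace_mul_diagonal_conj]
  simp only [Complex.re_sum, Finset.mul_sum, ← Finset.sum_sub_distrib]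
  refine Finset.sum_congr rfl fun j _ => Finset.sum_congr rfl fun i _ => ?_
  have hw : overlap hA hB j i = (W j i).re ^ 2 + (W j i).im ^ 2 := by
    rw [overlap, ← hU, ← hV, ← hW, Complex.normSq_apply]
    ring
  have hr : (a i - b j) ^ 2 / (b j + t * a i) =
      2 * (a i - b j) * r j i - (b j + t * a i) * r j i ^ 2 := by
    by_cases h0 : b j + t * a i = 0
    · simp [r, h0]
    · simp only [r]
      field_simp
      ring
  rw [hw, hr]
  simp only [y, Matrix.of_apply, Complex.star_def, map_mul, Complex.conj_ofReal, Complex.mul_re,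
    Complex.mul_im, Complex.ofReal_re, Complex.ofReal_im, Complex.conj_re, Complex.conj_im]
  ring

lemma conj_diag_eq_sum_overlap (hA : A.IsHermitian) (hB : B.IsHermitian) (j : Fin k) :
    (star (hB.eigenvectorUnitary : Matrix (Fin k) (Fin k) ℂ) * A *
      (hB.eigenvectorUnitary : Matrix (Fin k) (Fin k) ℂ)) j j =
      ((∑ i, overlap hA hB j i * hA.eigenvalues i : ℝ) : ℂ) := by
  set U := hA.eigenvectorUnitary with hU
  set V := hB.eigenvectorUnitary with hV
  have h : star (V : Matrix (Fin k) (Fin k) ℂ) * A * V =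
      (star (V : Matrix (Fin k) (Fin k) ℂ) * U) * (diagonal (fun i => (hA.eigenvalues i : ℂ)) *
        star (star (V : Matrix (Fin k) (Fin k) ℂ) * U)) := by
    conv_lhs => rw [spectral_eq hA]
    simp only [star_mul, star_star, Matrix.mul_assoc, ← hU]
  rw [h, Matrix.mul_apply, Complex.ofReal_sum]
  refine Finset.sum_congr rfl fun i _ => ?_
  rw [Matrix.diagonal_mul, Matrix.star_apply, overlap, ← hU, ← hV, Complex.ofReal_mul,
    ← Complex.mul_conj, Complex.star_def]
  ring

lemma sum_overlap_left (hA : A.IsHermitian) (hB : B.IsHermitian) (i : Fin k) :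
    ∑ j, overlap hA hB j i = 1 := by
  have h : star (star (hB.eigenvectorUnitary : Matrix (Fin k) (Fin k) ℂ) *
      hA.eigenvectorUnitary) * (star (hB.eigenvectorUnitary : Matrix (Fin k) (Fin k) ℂ) *
      hA.eigenvectorUnitary) = 1 := Unitary.coe_star_mul_self
        (star hB.eigenvectorUnitary * hA.eigenvectorUnitary)
  have hi := congrFun (congrFun h i) i
  rw [Matrix.mul_apply, Matrix.one_apply_eq] at hi
  apply Complex.ofReal_injective
  rw [Complex.ofReal_sum, Complex.ofReal_one, ← hi]
  refine Finset.sum_congr rfl fun j _ => ?_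
  rw [overlap, ← Complex.mul_conj, Matrix.star_apply, Complex.star_def, mul_comm]

lemma sum_overlap_right (hA : A.IsHermitian) (hB : B.IsHermitian) (j : Fin k) :
    ∑ i, overlap hA hB j i = 1 := by
  have h : (star (hB.eigenvectorUnitary : Matrix (Fin k) (Fin k) ℂ) * hA.eigenvectorUnitary) *
      star (star (hB.eigenvectorUnitary : Matrix (Fin k) (Fin k) ℂ) * hA.eigenvectorUnitary) =
      1 := Unitary.coe_mul_star_self (star hB.eigenvectorUnitary * hA.eigenvectorUnitary)
  have hj := congrFun (congrFun h j) j
  rw [Matrix.mul_apply, Matrix.one_apply_eq] at hj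
  apply Complex.ofReal_injective
  rw [Complex.ofReal_sum, Complex.ofReal_one, ← hj]
  refine Finset.sum_congr rfl fun i _ => ?_
  rw [overlap, ← Complex.mul_conj, Matrix.star_apply, Complex.star_def]

lemma overlap_mul_eigenvalue_eq_zero (hA : A.PosSemidef) (hB : B.IsHermitian) (h : SuppLE A B)
    {j : Fin k} (hj : hB.eigenvalues j = 0) (i : Fin k) :
    overlap hA.1 hB j i = 0 ∨ hA.1.eigenvalues i = 0 := by
  have h0 := h.conj_apply_eq_zero hB hj
    (star (hB.eigenvectorUnitary : Matrix (Fin k) (Fin k) ℂ)) j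
  rw [conj_diag_eq_sum_overlap hA.1 hB, Complex.ofReal_eq_zero] at h0
  have hnonneg : ∀ i ∈ Finset.univ, 0 ≤ overlap hA.1 hB j i * hA.1.eigenvalues i := fun i _ =>
    mul_nonneg (Complex.normSq_nonneg _) (hA.eigenvalues_nonneg i)
  exact mul_eq_zero.1 ((Finset.sum_eq_zero_iff_of_nonneg hnonneg).1 h0 i (Finset.mem_univ i))

lemma re_trace_mul_mlog (hA : A.IsHermitian) (hB : B.IsHermitian) :
    (A * mlog B).trace.re = ∑ j, ∑ i, overlap hA hB j i *
      (hA.eigenvalues i * Real.log (hB.eigenvalues j)) := by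
  rw [mlog_eq hB, trace_mul_conj_diagonal, Complex.re_sum]
  refine Finset.sum_congr rfl fun j _ => ?_
  rw [conj_diag_eq_sum_overlap hA hB, ← Complex.ofReal_mul, Complex.ofReal_re, Finset.mul_sum]
  refine Finset.sum_congr rfl fun i _ => ?_
  ring

lemma re_trace_mul_mlog_self (hA : A.IsHermitian) :
    (A * mlog A).trace.re = ∑ i, hA.eigenvalues i * Real.log (hA.eigenvalues i) := by
  have h : ∀ j i, overlap hA hA j i = if j = i then 1 else 0 := fun j i => by
    rw [overlap, Unitary.coe_star_mul_self, Matrix.one_apply]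
    split_ifs <;> simp
  simp [re_trace_mul_mlog hA hA, h]

lemma qRelEnt_eq_sum_overlap (hA : A.IsHermitian) (hB : B.IsHermitian) :
    qRelEnt A B - A.trace.re + B.trace.re = ∑ j, ∑ i, overlap hA hB j i *
      (hA.eigenvalues i * (Real.log (hA.eigenvalues i) - Real.log (hB.eigenvalues j)) -
        hA.eigenvalues i + hB.eigenvalues j) := by
  have h1 : ∀ f : Fin k → ℝ, ∑ j, ∑ i, overlap hA hB j i * f i = ∑ i, f i := fun f => by
    rw [Finset.sum_comm]
    simp [← Finset.sum_mul, sum_overlap_left]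
  have h2 : ∀ f : Fin k → ℝ, ∑ j, ∑ i, overlap hA hB j i * f j = ∑ j, f j := fun f => by
    simp [← Finset.sum_mul, sum_overlap_right]
  have hAt : A.trace.re = ∑ i, hA.eigenvalues i := by
    rw [hA.trace_eq_sum_eigenvalues, Complex.re_sum]; rfl
  have hBt : B.trace.re = ∑ i, hB.eigenvalues i := by
    rw [hB.trace_eq_sum_eigenvalues, Complex.re_sum]; rfl
  rw [qRelEnt, Matrix.mul_sub, Matrix.trace_sub, Complex.sub_re, re_trace_mul_mlog_self hA,
    re_trace_mul_mlog hA hB, hAt, hBt, ← h1, ← h1 hA.eigenvalues, ← h2 hB.eigenvalues]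
  simp only [← Finset.sum_sub_distrib, ← Finset.sum_add_distrib]
  refine Finset.sum_congr rfl fun j _ => Finset.sum_congr rfl fun i _ => ?_
  ring

end Overlap

section BlahutArimoto

variable {n m : ℕ} {ρ : Fin n → Matrix (Fin m) (Fin m) ℂ} {p q : Fin n → ℝ}

/-- Data processing for the preparation channel of a classical-quantum channel. -/
lemma qRelEnt_mixture_le (hρ : ∀ x, IsDensity (ρ x)) (hp : ∀ x, 0 ≤ p x) (hq : ∀ x, 0 < q x) :
    qRelEnt (∑ x, (p x : ℂ) • ρ x) (∑ x, (q x : ℂ) • ρ x) ≤ cRelEnt p q := by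
  have hA := posSemidef_mixture hρ hp
  have hB := posSemidef_mixture hρ fun x => (hq x).le
  have htr : ∀ r : Fin n → ℝ, (∑ x, (r x : ℂ) • ρ x).trace.re = ∑ x, r x := fun r => by
    simp [Matrix.trace_sum, (hρ _).2]
  have key := sum_mul_log_sub_le_of_kernel_le
    (w := fun i : Fin m × Fin m => overlap hA.1 hB.1 i.1 i.2)
    (a := fun i => hA.1.eigenvalues i.2) (b := fun i => hB.1.eigenvalues i.1)
    (fun i => hA.eigenvalues_nonneg _) (fun i => hB.eigenvalues_nonneg _)
    (fun i hi => overlap_mul_eigenvalue_eq_zero hA hB.1 (suppLE_mixture_mixture hρ hq) hi i.2)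
    hp hq fun t ht => by
      obtain ⟨Y, hY⟩ := exists_kernel_eq_quadratic_form hA.1 hB.1 t
      rw [Fintype.sum_prod_type, hY]
      simp only [re_trace_mixture_mul, Finset.mul_sum, ← Finset.sum_sub_distrib]
      refine Finset.sum_le_sum fun x _ => ?_
      have := (hρ x).quadratic_form_le Y (hp x) (hq x) ht
      linarith
  rw [Fintype.sum_prod_type, ← qRelEnt_eq_sum_overlap, htr, htr, Finset.sum_add_distrib,
    Finset.sum_sub_distrib] at key
  rw [cRelEnt]
  linarith

lemma fBA_eq (hρ : ∀ x, IsDensity (ρ x)) (s : Fin n → ℝ) (lam : ℝ) (hp : ∀ x, 0 < p x)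
    (hq : ∀ x, 0 < q x) :
    fBA ρ s lam p q = -cRelEnt p q - (∑ x, p x * vN (ρ x)) -
      ((∑ x, (p x : ℂ) • ρ x) * mlog (∑ x, (q x : ℂ) • ρ x)).trace.re -
      lam * ∑ x, s x * p x := by
  have hB := posSemidef_mixture hρ fun x => (hq x).le
  rw [fBA, re_trace_mixture_mul, cRelEnt, ← Finset.sum_neg_distrib, ← Finset.sum_sub_distrib,
    ← Finset.sum_sub_distrib]
  congr 1
  refine Finset.sum_congr rfl fun x _ => ?_
  rw [Matrix.mul_sub, Matrix.smul_mul, Matrix.smul_mul, Matrix.trace_sub, Matrix.trace_smul,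
    Matrix.trace_smul, trace_mul_mlog_smul (hρ x).1.1 (fun _ hv => hv) (hq x),
    trace_mul_mlog_smul hB.1 (suppLE_mixture hρ hq x) (hp x), (hρ x).2, vN]
  simp only [smul_eq_mul, mul_one, Complex.sub_re, Complex.re_ofReal_mul, Complex.add_re,
    Complex.ofReal_re]
  ring

end BlahutArimoto

/-- `max_{p'} f_λ(p, p') = f_λ(p, p) = H(Σ_x p_x ρ_x) − Σ_x p_x H(ρ_x) − λ sᵀp`. -/
theorem stmt_2 {n m : ℕ} (lam : ℝ) (hlam : 0 ≤ lam)
    (s : Fin n → ℝ) (hs : ∀ x, 0 ≤ s x)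
    (ρ : Fin n → Matrix (Fin m) (Fin m) ℂ) (hρ : ∀ x, IsDensity (ρ x))
    (p : Fin n → ℝ) (hp : IsDist p) (hppos : ∀ x, 0 < p x) :
    IsGreatest {y : ℝ | ∃ p' : Fin n → ℝ, IsDist p' ∧ (∀ x, 0 < p' x) ∧
        y = fBA ρ s lam p p'} (fBA ρ s lam p p) ∧
    fBA ρ s lam p p = holevo ρ p - lam * ∑ x, s x * p x := by
  have hself : cRelEnt p p = 0 := by simp [cRelEnt]
  refine ⟨⟨⟨p, hp, hppos, rfl⟩, ?_⟩, ?_⟩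
  · rintro _ ⟨q, hq, hqpos, rfl⟩
    have h := qRelEnt_mixture_le hρ hp.1 hqpos
    rw [qRelEnt, Matrix.mul_sub, Matrix.trace_sub, Complex.sub_re] at h
    rw [fBA_eq hρ s lam hppos hqpos, fBA_eq hρ s lam hppos hppos, hself]
    linarith
  · rw [fBA_eq hρ s lam hppos hppos, hself, holevo, vN]
    ring
end

section
/- Fix λ ≥ 0, a cost vector s ≥ 0 and a classical-quantum channel (ρ_x)_{x∈X}. Let p^t be a strictly positive probability distribution on X, set r_x^t = exp(Tr{ρ_x[log(p^t_x ρ_x) − log ρ^t]} − λ s_x) with ρ^t = Σ_x p^t_x ρ_x, and let p^{t+1}_x = r_x^t / Σ_{x'} r_{x'}^t be the Blahut–Arimoto update. Then f_λ(p^{t+1}, p^t) = log(Σ_x r_x^t). -/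
open Matrix Finset Filter ComplexOrder

lemma mlog_eq_cfc {k : ℕ} {A : Matrix (Fin k) (Fin k) ℂ} (hA : A.IsHermitian) :
    mlog A = cfc Real.log A := by
  rw [hA.cfc_eq, Matrix.IsHermitian.cfc, mlog, dif_pos hA, Unitary.conjStarAlgAut_apply]
  rfl

lemma SuppLE.mul_eq_zero {k : ℕ} {B A Q : Matrix (Fin k) (Fin k) ℂ} (h : SuppLE B A)
    (hQ : A * Q = 0) : B * Q = 0 := by
  refine Matrix.ext_of_mulVec_single fun i => ?_
  rw [← Matrix.mulVec_mulVec, Matrix.zero_mulVec]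
  apply h
  rw [Matrix.mulVec_mulVec, hQ, Matrix.zero_mulVec]

lemma mul_mlog_smul {k : ℕ} {B A : Matrix (Fin k) (Fin k) ℂ} (hA : A.IsHermitian)
    (h : SuppLE B A) {c : ℝ} (hc : c ≠ 0) :
    B * mlog ((c : ℂ) • A) = B * mlog A + (Real.log c : ℂ) • B := by
  have hcont (f : ℝ → ℝ) : ContinuousOn f (spectrum ℝ A) := A.finite_real_spectrum.continuousOn f
  set P : ℝ → ℝ := fun x => if x = 0 then 0 else 1 with hP
  have hA' : IsSelfAdjoint A := hA
  have hcA : (c : ℂ) • A = c • A := Complex.coe_smul c A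
  have hsmul : mlog ((c : ℂ) • A) = mlog A + (Real.log c : ℂ) • cfc P A := by
    rw [hcA, mlog_eq_cfc hA, mlog_eq_cfc (IsSelfAdjoint.smul (IsSelfAdjoint.all c) hA'),
      ← cfc_comp_const_mul c Real.log A ((A.finite_real_spectrum.image _).continuousOn _) hA',
      Complex.coe_smul, ← cfc_const_mul _ P A (hcont _), ← cfc_add A _ _ (hcont _) (hcont _)]
    congr 1
    ext x
    by_cases hx : x = 0
    · simp [hP, hx]
    · simp [hP, hx, Real.log_mul hc hx, add_comm]
  have hAP : A * cfc P A = A := by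
    nth_rw 1 [← cfc_id' ℝ A hA']
    rw [← cfc_mul _ _ A (hcont _) (hcont _)]
    conv_rhs => rw [← cfc_id' ℝ A hA']
    congr 1
    ext x
    by_cases hx : x = 0 <;> simp [hP, hx]
  have hBP : B * cfc P A = B := by
    have := h.mul_eq_zero (Q := 1 - cfc P A) (by rw [mul_sub, hAP, mul_one, sub_self])
    rw [mul_sub, mul_one, sub_eq_zero] at this
    exact this.symm
  rw [hsmul, mul_add, Matrix.mul_smul, hBP]

lemma suppLE_sum_smul {n m : ℕ} {ρ : Fin n → Matrix (Fin m) (Fin m) ℂ}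
    (hρ : ∀ x, (ρ x).PosSemidef) {p : Fin n → ℝ} (hp : ∀ x, 0 < p x) (x : Fin n) :
    SuppLE (ρ x) (∑ y, (p y : ℂ) • ρ y) := by
  intro v hv
  have hnonneg (y : Fin n) : 0 ≤ (p y : ℂ) * (star v ⬝ᵥ ρ y *ᵥ v) :=
    mul_nonneg (by exact_mod_cast (hp y).le) ((hρ y).dotProduct_mulVec_nonneg v)
  have hsum : ∑ y, (p y : ℂ) * (star v ⬝ᵥ ρ y *ᵥ v) = 0 := by
    have := congrArg (star v ⬝ᵥ ·) hv
    simpa [Matrix.sum_mulVec, dotProduct_sum, Matrix.smul_mulVec, dotProduct_smul] using this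
  have hx := (Finset.sum_eq_zero_iff_of_nonneg fun y _ => hnonneg y).1 hsum x (mem_univ x)
  rw [← (hρ x).dotProduct_mulVec_zero_iff]
  exact (mul_eq_zero.1 hx).resolve_left (by exact_mod_cast (hp x).ne')

lemma fBA_eq_sum {n m : ℕ} (lam : ℝ) (s : Fin n → ℝ) {ρ : Fin n → Matrix (Fin m) (Fin m) ℂ}
    (hρ : ∀ x, IsDensity (ρ x)) {p p' : Fin n → ℝ} (hp : ∀ x, p x ≠ 0) (hp' : ∀ x, 0 < p' x) :
    fBA ρ s lam p p' = ∑ x, p x * (Real.log (rBA ρ s lam p' x) - Real.log (p x)) := by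
  have hherm : (∑ y, (p' y : ℂ) • ρ y).IsHermitian :=
    (Matrix.posSemidef_sum _ fun y _ =>
      (hρ y).1.smul (by exact_mod_cast (hp' y).le)).isHermitian
  rw [fBA, mul_sum, ← sum_sub_distrib]
  refine sum_congr rfl fun x _ => ?_
  rw [rBA, Real.log_exp, Matrix.smul_mul, mul_sub (ρ x), mul_sub (ρ x),
    mul_mlog_smul hherm (suppLE_sum_smul (fun y => (hρ y).1) hp' x) (hp x),
    Matrix.trace_smul, Matrix.trace_sub, Matrix.trace_sub, Matrix.trace_add, Matrix.trace_smul,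
    (hρ x).2, smul_eq_mul, smul_eq_mul, mul_one, Complex.re_ofReal_mul, Complex.sub_re,
    Complex.sub_re, Complex.add_re, Complex.ofReal_re]
  ring

/-- Corollary 1: `f_λ(p^{t+1}, p^t) = log(Σ_x r_x^t)` for the
Blahut–Arimoto update `p^{t+1}` of a strictly positive distribution `p^t`. -/
theorem stmt_5 {n m : ℕ} (lam : ℝ) (hlam : 0 ≤ lam)
    (s : Fin n → ℝ) (hs : ∀ x, 0 ≤ s x)
    (ρ : Fin n → Matrix (Fin m) (Fin m) ℂ) (hρ : ∀ x, IsDensity (ρ x))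
    (pt : Fin n → ℝ) (hpt : IsDist pt) (hptpos : ∀ x, 0 < pt x) :
    fBA ρ s lam (baStep ρ s lam pt) pt = Real.log (∑ x, rBA ρ s lam pt x) := by
  have hne : (univ : Finset (Fin n)).Nonempty := by
    by_contra h
    have h1 := hpt.2
    rw [not_nonempty_iff_eq_empty.1 h, sum_empty] at h1
    exact zero_ne_one h1
  have hr (x : Fin n) : 0 < rBA ρ s lam pt x := Real.exp_pos _
  have hR : 0 < ∑ x, rBA ρ s lam pt x := sum_pos (fun x _ => hr x) hne
  rw [fBA_eq_sum lam s hρ (p := baStep ρ s lam pt) (fun x => (div_pos (hr x) hR).ne') hptpos]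
  have hlog (x : Fin n) : Real.log (rBA ρ s lam pt x) - Real.log (baStep ρ s lam pt x) =
      Real.log (∑ y, rBA ρ s lam pt y) := by
    rw [baStep, Real.log_div (hr x).ne' hR.ne']
    ring
  simp_rw [hlog]
  rw [← sum_mul]
  simp_rw [baStep]
  rw [← sum_div, div_self hR.ne', one_mul]
end
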